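/- Let g be a 2n-dimensional real nilpotent Lie algebra with a complex structure J, and suppose g_k ∩ J(g_k) = {0} for some k ≥ 1 with dim g_k = n - r for some r ≥ 1. Then g_{k+r-1} ∩ J(g_{k+r-1}) ≠ {0} and dim g_{k+r-1} ≥ n. -/

import Mathlib

/-- The ascending central series of a Lie algebra:
`acs g 0 = 0`, `acs g (k+1) = {X | [X,g] ⊆ acs g k}`. -/
def acs (g : Type*) [LieRing g] [LieAlgebra ℝ g] : ℕ → Submodule ℝ g
  | 0 => ⊥
  | k + 1 =>
    { carrier := {X : g | ∀ Y : g, ⁅X, Y⁆ ∈ acs g k}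
      zero_mem' := by intro Y; simp
      add_mem' := by
        intro a b ha hb Y
        rw [add_lie]; exact (acs g k).add_mem (ha Y) (hb Y)
      smul_mem' := by
        intro c x hx Y
        rw [smul_lie]; exact (acs g k).smul_mem c (hx Y) }

section AscendingCentralSeries

variable {g : Type*} [LieRing g] [LieAlgebra ℝ g]

theorem mem_acs_succ {k : ℕ} {X : g} : X ∈ acs g (k + 1) ↔ ∀ Y : g, ⁅X, Y⁆ ∈ acs g k :=
  Iff.rfl

theorem acs_le_succ (k : ℕ) : acs g k ≤ acs g (k + 1) := by
  induction k with
  | zero => exact bot_le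
  | succ k ih => exact fun X hX Y => ih (hX Y)

theorem acs_mono : Monotone (acs g) :=
  monotone_nat_of_le_succ acs_le_succ

theorem acs_add_eq_of_succ_eq {k : ℕ} (h : acs g (k + 1) = acs g k) (j : ℕ) :
    acs g (k + j) = acs g k := by
  induction j with
  | zero => rfl
  | succ j ih =>
    rw [← h]
    ext X
    rw [← add_assoc, mem_acs_succ, mem_acs_succ, ih]

/-- The ascending central series of a nilpotent Lie algebra increases strictly until it
exhausts the algebra. -/
theorem acs_lt_succ (hnil : ∃ s : ℕ, acs g s = ⊤) {k : ℕ} (hk : acs g k ≠ ⊤) :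
    acs g k < acs g (k + 1) := by
  refine lt_of_le_of_ne (acs_le_succ k) fun h => hk ?_
  obtain ⟨s, hs⟩ := hnil
  rw [← acs_add_eq_of_succ_eq h.symm s, eq_top_iff, ← hs]
  exact acs_mono (Nat.le_add_left s k)

end AscendingCentralSeries

section ComplexStructure

variable {g : Type*} [AddCommGroup g] [Module ℝ g] {J : g →ₗ[ℝ] g}

theorem injective_of_sq_eq_neg (hJ2 : ∀ X : g, J (J X) = -X) : Function.Injective J := by
  intro X Y h
  have := congrArg J h
  rwa [hJ2, hJ2, neg_inj] at this

theorem mem_map_iff_of_sq_eq_neg (hJ2 : ∀ X : g, J (J X) = -X) {V : Submodule ℝ g} {X : g} :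
    X ∈ V.map J ↔ J X ∈ V := by
  constructor
  · rintro ⟨Y, hY, rfl⟩
    rw [hJ2]
    exact V.neg_mem hY
  · intro h
    exact ⟨-J X, V.neg_mem h, by rw [map_neg, hJ2, neg_neg]⟩

theorem inf_map_eq_bot_iff (hJ2 : ∀ X : g, J (J X) = -X) {U V : Submodule ℝ g} :
    U ⊓ V.map J = ⊥ ↔ ∀ X ∈ U, J X ∈ V → X = 0 := by
  simp only [Submodule.eq_bot_iff, Submodule.mem_inf, mem_map_iff_of_sq_eq_neg hJ2, and_imp]

theorem finrank_map_of_sq_eq_neg (hJ2 : ∀ X : g, J (J X) = -X) (V : Submodule ℝ g) :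
    Module.finrank ℝ (V.map J) = Module.finrank ℝ V :=
  (Submodule.equivMapOfInjective J (injective_of_sq_eq_neg hJ2) V).finrank_eq.symm

variable [FiniteDimensional ℝ g]

theorem finrank_add_eq_of_inf_eq_bot {U V : Submodule ℝ g} (h : U ⊓ V = ⊥) :
    Module.finrank ℝ U + Module.finrank ℝ V = Module.finrank ℝ (U ⊔ V : Submodule ℝ g) := by
  have := Submodule.finrank_sup_add_finrank_inf_eq U V
  rw [h, finrank_bot] at this
  exact this.symm

theorem two_le_finrank_of_map_mem (hJ2 : ∀ X : g, J (J X) = -X) {W : Submodule ℝ g}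
    (hW : W ≠ ⊥) (hJW : ∀ X ∈ W, J X ∈ W) : 2 ≤ Module.finrank ℝ W := by
  obtain ⟨w, hw, hw0⟩ := Submodule.exists_mem_ne_zero_of_ne_bot hW
  have hli : LinearIndependent ℝ ![(⟨w, hw⟩ : W), ⟨J w, hJW w hw⟩] := by
    rw [LinearIndependent.pair_iff]
    intro a b hab
    have h1 : a • w + b • J w = 0 := congrArg Subtype.val hab
    have h2 : a • J w - b • w = 0 := by
      have := congrArg J h1
      rw [map_add, map_smul, map_smul, hJ2, map_zero, smul_neg, ← sub_eq_add_neg] at this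
      exact this
    have h3 : (a * a + b * b) • w = 0 := by
      calc (a * a + b * b) • w = a • (a • w + b • J w) - b • (a • J w - b • w) := by module
        _ = 0 := by rw [h1, h2, smul_zero, smul_zero, sub_zero]
    have h4 := (smul_eq_zero.mp h3).resolve_right hw0
    constructor <;> nlinarith [mul_self_nonneg a, mul_self_nonneg b]
  simpa using hli.fintype_card_le_finrank

end ComplexStructure

section Nijenhuis

variable {g : Type*} [LieRing g] [LieAlgebra ℝ g] {J : g →ₗ[ℝ] g}

theorem map_lie_add_lie_map
    (hN : ∀ X Y : g, ⁅X, Y⁆ + J ⁅J X, Y⁆ + J ⁅X, J Y⁆ - ⁅J X, J Y⁆ = 0) (X Y : g) :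
    J (⁅J X, Y⁆ + ⁅X, J Y⁆) = ⁅J X, J Y⁆ - ⁅X, Y⁆ := by
  rw [← sub_eq_zero.mp (hN X Y), map_add]
  abel

theorem lie_map_mem_acs_of_inf_eq_bot (hJ2 : ∀ X : g, J (J X) = -X)
    (hN : ∀ X Y : g, ⁅X, Y⁆ + J ⁅J X, Y⁆ + J ⁅X, J Y⁆ - ⁅J X, J Y⁆ = 0) {i : ℕ}
    (h : acs g (i + 1) ⊓ (acs g (i + 1)).map J = ⊥) {X Y : g} (hX : X ∈ acs g (i + 1))
    (h₁ : ⁅J X, Y⁆ ∈ acs g (i + 1)) (h₂ : ⁅J X, J Y⁆ ∈ acs g (i + 1)) :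
    ⁅J X, Y⁆ ∈ acs g i ∧ ⁅J X, J Y⁆ ∈ acs g i := by
  have hle := acs_le_succ (g := g) i
  have key := map_lie_add_lie_map hN X Y
  have hzero : ⁅J X, Y⁆ + ⁅X, J Y⁆ = 0 :=
    (inf_map_eq_bot_iff hJ2).mp h _ (add_mem h₁ (hle (hX _)))
      (key ▸ sub_mem h₂ (hle (hX _)))
  rw [hzero, map_zero] at key
  rw [eq_neg_of_add_eq_zero_left hzero, sub_eq_zero.mp key.symm]
  exact ⟨neg_mem (hX _), hX _⟩

theorem acs_succ_inf_map_acs_eq_bot (hJ2 : ∀ X : g, J (J X) = -X)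
    (hN : ∀ X Y : g, ⁅X, Y⁆ + J ⁅J X, Y⁆ + J ⁅X, J Y⁆ - ⁅J X, J Y⁆ = 0) {i : ℕ}
    (h : acs g (i + 1) ⊓ (acs g (i + 1)).map J = ⊥) :
    acs g (i + 2) ⊓ (acs g (i + 1)).map J = ⊥ := by
  rw [Submodule.eq_bot_iff]
  rintro _ ⟨hJX, X, hX, rfl⟩
  have : J X ∈ acs g (i + 1) := fun Y =>
    (lie_map_mem_acs_of_inf_eq_bot hJ2 hN h hX (hJX Y) (hJX (J Y))).1
  rw [(inf_map_eq_bot_iff hJ2).mp h X hX this, map_zero]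

theorem acs_succ_inf_map_inf_sup_eq_bot (hJ2 : ∀ X : g, J (J X) = -X)
    (hN : ∀ X Y : g, ⁅X, Y⁆ + J ⁅J X, Y⁆ + J ⁅X, J Y⁆ - ⁅J X, J Y⁆ = 0) {i : ℕ}
    (h : acs g (i + 1) ⊓ (acs g (i + 1)).map J = ⊥) :
    (acs g (i + 2) ⊓ (acs g (i + 2)).map J) ⊓ (acs g (i + 1) ⊔ (acs g (i + 1)).map J) = ⊥ := by
  have hUJV := acs_succ_inf_map_acs_eq_bot hJ2 hN h
  rw [Submodule.eq_bot_iff]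
  rintro X ⟨⟨hXU, hXJU⟩, hX⟩
  obtain ⟨v, hv, w, hw, rfl⟩ := Submodule.mem_sup.mp hX
  have hwU : w ∈ acs g (i + 2) := (Submodule.add_mem_iff_right _ (acs_le_succ _ hv)).mp hXU
  have hw0 : w = 0 := (Submodule.eq_bot_iff _).mp hUJV w ⟨hwU, hw⟩
  rw [hw0, add_zero] at hXJU ⊢
  have hJv : J v = 0 := (Submodule.eq_bot_iff _).mp hUJV (J v)
    ⟨(mem_map_iff_of_sq_eq_neg hJ2).mp hXJU, Submodule.mem_map_of_mem hv⟩
  exact injective_of_sq_eq_neg hJ2 (hJv.trans (map_zero J).symm)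

theorem map_mem_acs_of_sup_eq_top (hJ2 : ∀ X : g, J (J X) = -X)
    (hN : ∀ X Y : g, ⁅X, Y⁆ + J ⁅J X, Y⁆ + J ⁅X, J Y⁆ - ⁅J X, J Y⁆ = 0) {i : ℕ}
    (h : acs g (i + 1) ⊓ (acs g (i + 1)).map J = ⊥)
    (hsup : (acs g (i + 2) ⊓ (acs g (i + 2)).map J) ⊔
      (acs g (i + 1) ⊔ (acs g (i + 1)).map J) = ⊤)
    {X : g} (hX : X ∈ acs g (i + 1)) (hJX : J X ∈ acs g (i + 3)) : J X ∈ acs g (i + 1) := by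
  have hUJV := acs_succ_inf_map_acs_eq_bot hJ2 hN h
  have hlie : ∀ Y ∈ acs g (i + 2), ⁅J X, Y⁆ ∈ acs g (i + 1) := by
    intro Y hY
    rw [← lie_skew]
    exact neg_mem (hY _)
  have hV : ∀ Y ∈ acs g (i + 1), ⁅J X, Y⁆ ∈ acs g i ∧ ⁅J X, J Y⁆ ∈ acs g i := by
    intro Y hY
    have h₁ := hlie Y (acs_le_succ _ hY)
    refine lie_map_mem_acs_of_inf_eq_bot hJ2 hN h hX h₁ ?_
    have hB : ⁅J X, Y⁆ + ⁅X, J Y⁆ ∈ acs g (i + 1) := add_mem h₁ (acs_le_succ _ (hX _))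
    have key := map_lie_add_lie_map hN X Y
    have hXY : ⁅X, Y⁆ ∈ acs g (i + 1) := acs_le_succ _ (hX _)
    have hzero : J (⁅J X, Y⁆ + ⁅X, J Y⁆) = 0 := (Submodule.eq_bot_iff _).mp hUJV _
      ⟨key ▸ sub_mem (hJX _) (acs_le_succ _ hXY), Submodule.mem_map_of_mem hB⟩
    rw [hzero] at key
    rwa [sub_eq_zero.mp key.symm]
  intro Y
  obtain ⟨w, ⟨hwU, hwJU⟩, z, hz, rfl⟩ := Submodule.mem_sup.mp (hsup ▸ Submodule.mem_top : Y ∈ _)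
  obtain ⟨v, hv, _, ⟨u, hu, rfl⟩, rfl⟩ := Submodule.mem_sup.mp hz
  rw [lie_add, lie_add]
  refine add_mem ?_ (add_mem (hV v hv).1 (hV u hu).2)
  exact (lie_map_mem_acs_of_inf_eq_bot hJ2 hN h hX (hlie w hwU)
    (hlie _ ((mem_map_iff_of_sq_eq_neg hJ2).mp hwJU))).1

variable [FiniteDimensional ℝ g] {n : ℕ}

theorem finrank_acs_add_one_le (hn : 1 ≤ n) (hdim : Module.finrank ℝ g = 2 * n)
    (hnil : ∃ s : ℕ, acs g s = ⊤) (hJ2 : ∀ X : g, J (J X) = -X)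
    (hN : ∀ X Y : g, ⁅X, Y⁆ + J ⁅J X, Y⁆ + J ⁅X, J Y⁆ - ⁅J X, J Y⁆ = 0) {i : ℕ}
    (h : acs g (i + 1) ⊓ (acs g (i + 1)).map J = ⊥) :
    Module.finrank ℝ (acs g (i + 1)) + 1 ≤ n := by
  have hVJV := finrank_add_eq_of_inf_eq_bot h
  have hVJV_le := Submodule.finrank_le (acs g (i + 1) ⊔ (acs g (i + 1)).map J)
  have hUJV := finrank_add_eq_of_inf_eq_bot (acs_succ_inf_map_acs_eq_bot hJ2 hN h)
  have hUJV_le := Submodule.finrank_le (acs g (i + 2) ⊔ (acs g (i + 1)).map J)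
  rw [finrank_map_of_sq_eq_neg hJ2] at hVJV hUJV
  have htop : acs g (i + 1) ≠ ⊤ := by
    intro htop
    rw [htop, finrank_top] at hVJV
    rw [htop] at hVJV_le
    omega
  have hlt := Submodule.finrank_lt_finrank_of_lt (acs_lt_succ hnil htop)
  change _ < Module.finrank ℝ (acs g (i + 2)) at hlt
  omega

/-- A positive term `g_m` of the ascending central series with `g_m ∩ J(g_m) = 0` has dimension
at most `n - 2`. -/
theorem finrank_acs_add_two_le (hn : 1 ≤ n) (hdim : Module.finrank ℝ g = 2 * n)
    (hnil : ∃ s : ℕ, acs g s = ⊤) (hJ2 : ∀ X : g, J (J X) = -X)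
    (hN : ∀ X Y : g, ⁅X, Y⁆ + J ⁅J X, Y⁆ + J ⁅X, J Y⁆ - ⁅J X, J Y⁆ = 0) {i : ℕ}
    (h : acs g (i + 1) ⊓ (acs g (i + 1)).map J = ⊥) :
    Module.finrank ℝ (acs g (i + 1)) + 2 ≤ n := by
  by_contra hlt
  have hone := finrank_acs_add_one_le hn hdim hnil hJ2 hN h
  have ne_top_of_finrank_lt : ∀ {V : Submodule ℝ g}, Module.finrank ℝ V < 2 * n → V ≠ ⊤ := by
    rintro V hV rfl
    rw [finrank_top] at hV
    omega
  have hUJV := finrank_add_eq_of_inf_eq_bot (acs_succ_inf_map_acs_eq_bot hJ2 hN h)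
  have hUJV_le := Submodule.finrank_le (acs g (i + 2) ⊔ (acs g (i + 1)).map J)
  rw [finrank_map_of_sq_eq_neg hJ2] at hUJV
  have hVU : Module.finrank ℝ (acs g (i + 1)) < Module.finrank ℝ (acs g (i + 2)) :=
    Submodule.finrank_lt_finrank_of_lt (acs_lt_succ hnil (ne_top_of_finrank_lt (by omega)))
  have hV0 : 0 < Module.finrank ℝ (acs g (i + 1)) := by
    refine (Nat.zero_le _).trans_lt (Submodule.finrank_lt_finrank_of_lt
      (acs_lt_succ hnil (k := i) (ne_top_of_finrank_lt ?_)))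
    have := Submodule.finrank_mono (acs_le_succ (g := g) i)
    omega
  have hW0 : acs g (i + 2) ⊓ (acs g (i + 2)).map J ≠ ⊥ := by
    intro hU
    have : Module.finrank ℝ (acs g (i + 2)) + 1 ≤ n :=
      finrank_acs_add_one_le (i := i + 1) hn hdim hnil hJ2 hN hU
    omega
  have hW2 := two_le_finrank_of_map_mem hJ2 hW0 fun X hX =>
    ⟨(mem_map_iff_of_sq_eq_neg hJ2).mp hX.2, Submodule.mem_map_of_mem hX.1⟩
  have hsup : (acs g (i + 2) ⊓ (acs g (i + 2)).map J) ⊔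
      (acs g (i + 1) ⊔ (acs g (i + 1)).map J) = ⊤ := by
    apply Submodule.eq_top_of_finrank_eq
    have h₁ := finrank_add_eq_of_inf_eq_bot (acs_succ_inf_map_inf_sup_eq_bot hJ2 hN h)
    have h₂ := finrank_add_eq_of_inf_eq_bot h
    rw [finrank_map_of_sq_eq_neg hJ2] at h₂
    refine le_antisymm (Submodule.finrank_le _) ?_
    omega
  have hU := acs_lt_succ hnil (ne_top_of_finrank_lt (V := acs g (i + 2)) (by omega))
  obtain ⟨X, hX, hXU⟩ := SetLike.exists_of_lt hU
  obtain ⟨w, hw, z, hz, rfl⟩ := Submodule.mem_sup.mp (hsup ▸ Submodule.mem_top : X ∈ _)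
  obtain ⟨v, hv, _, ⟨u, hu, rfl⟩, rfl⟩ := Submodule.mem_sup.mp hz
  have hvU : v ∈ acs g (i + 2) := acs_le_succ _ hv
  have hJu : J u ∈ acs g (i + 3) := by
    rwa [Submodule.add_mem_iff_right _ (hU.le hw.1),
      Submodule.add_mem_iff_right _ (hU.le hvU)] at hX
  have hJuU : J u ∈ acs g (i + 2) :=
    acs_le_succ _ (map_mem_acs_of_sup_eq_top hJ2 hN h hsup hu hJu)
  exact hXU (add_mem hw.1 (add_mem hvU hJuU))

/-- The first term of the ascending central series that meets its image under `J` nontrivially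
exceeds the preceding one by at least two dimensions. -/
theorem finrank_acs_add_two_le_succ (hJ2 : ∀ X : g, J (J X) = -X)
    (hN : ∀ X Y : g, ⁅X, Y⁆ + J ⁅J X, Y⁆ + J ⁅X, J Y⁆ - ⁅J X, J Y⁆ = 0) {i : ℕ}
    (h : acs g (i + 1) ⊓ (acs g (i + 1)).map J = ⊥)
    (h' : acs g (i + 2) ⊓ (acs g (i + 2)).map J ≠ ⊥) :
    Module.finrank ℝ (acs g (i + 1)) + 2 ≤ Module.finrank ℝ (acs g (i + 2)) := by
  have hW2 := two_le_finrank_of_map_mem hJ2 h' fun X hX =>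
    ⟨(mem_map_iff_of_sq_eq_neg hJ2).mp hX.2, Submodule.mem_map_of_mem hX.1⟩
  have hWV : (acs g (i + 2) ⊓ (acs g (i + 2)).map J) ⊓ acs g (i + 1) = ⊥ :=
    eq_bot_mono (inf_le_inf_left _ le_sup_left) (acs_succ_inf_map_inf_sup_eq_bot hJ2 hN h)
  have hadd := finrank_add_eq_of_inf_eq_bot hWV
  have hle := Submodule.finrank_mono (sup_le inf_le_left (acs_le_succ (i + 1)) :
    (acs g (i + 2) ⊓ (acs g (i + 2)).map J) ⊔ acs g (i + 1) ≤ acs g (i + 2))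
  omega

theorem finrank_acs_growth (hnil : ∃ s : ℕ, acs g s = ⊤) (hdim : Module.finrank ℝ g = 2 * n)
    (hJ2 : ∀ X : g, J (J X) = -X)
    (hN : ∀ X Y : g, ⁅X, Y⁆ + J ⁅J X, Y⁆ + J ⁅X, J Y⁆ - ⁅J X, J Y⁆ = 0) {i : ℕ}
    (h : acs g (i + 1) ⊓ (acs g (i + 1)).map J = ⊥) (j : ℕ) :
    (acs g (i + j + 1) ⊓ (acs g (i + j + 1)).map J = ⊥ ∨
      Module.finrank ℝ (acs g (i + 1)) + j + 1 ≤ Module.finrank ℝ (acs g (i + j + 1))) ∧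
      Module.finrank ℝ (acs g (i + 1)) + j ≤ Module.finrank ℝ (acs g (i + j + 1)) ∨
    n ≤ Module.finrank ℝ (acs g (i + j + 1)) := by
  induction j with
  | zero => exact Or.inl ⟨Or.inl h, le_rfl⟩
  | succ j ih =>
    have hmono := Submodule.finrank_mono (acs_le_succ (g := g) (i + j + 1))
    change (acs g (i + j + 2) ⊓ (acs g (i + j + 2)).map J = ⊥ ∨
      _ ≤ Module.finrank ℝ (acs g (i + j + 2))) ∧ _ ≤ Module.finrank ℝ (acs g (i + j + 2)) ∨
      _ ≤ Module.finrank ℝ (acs g (i + j + 2))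
    change _ ≤ Module.finrank ℝ (acs g (i + j + 2)) at hmono
    rcases ih with ⟨hdisj, hfin⟩ | hn
    · by_cases htop : acs g (i + j + 1) = ⊤
      · rw [htop, finrank_top] at hmono
        exact Or.inr (by omega)
      · have hlt : Module.finrank ℝ (acs g (i + j + 1)) < Module.finrank ℝ (acs g (i + j + 2)) :=
          Submodule.finrank_lt_finrank_of_lt (acs_lt_succ hnil htop)
        refine Or.inl ⟨or_iff_not_imp_left.mpr fun hnext => ?_, by omega⟩
        rcases hdisj with hdisj | hfin'
        · have := finrank_acs_add_two_le_succ hJ2 hN hdisj hnext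
          omega
        · omega
    · exact Or.inr (hn.trans hmono)

end Nijenhuis

/-- if `g_k ∩ J(g_k) = 0` for some `k ≥ 1` and `dim g_k = n - r`
with `r ≥ 1`, then `g_{k+r-1} ∩ J(g_{k+r-1}) ≠ 0` and `dim g_{k+r-1} ≥ n`. -/
theorem acs_inf_J_ne_bot_and_dim_ge (g : Type*) [LieRing g] [LieAlgebra ℝ g]
    [FiniteDimensional ℝ g] (n : ℕ) (hdim : Module.finrank ℝ g = 2 * n)
    (hnil : ∃ s : ℕ, acs g s = ⊤)
    (J : g →ₗ[ℝ] g) (hJ2 : ∀ X : g, J (J X) = -X)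
    (hN : ∀ X Y : g, ⁅X, Y⁆ + J ⁅J X, Y⁆ + J ⁅X, J Y⁆ - ⁅J X, J Y⁆ = 0)
    (k : ℕ) (hk : 1 ≤ k)
    (h : acs g k ⊓ (acs g k).map J = ⊥)
    (r : ℕ) (hr : 1 ≤ r)
    (hdimk : Module.finrank ℝ (acs g k) + r = n) :
    acs g (k + r - 1) ⊓ (acs g (k + r - 1)).map J ≠ ⊥ ∧
      n ≤ Module.finrank ℝ (acs g (k + r - 1)) := by
  obtain ⟨i, rfl⟩ := Nat.exists_eq_add_of_le' hk
  obtain ⟨j, rfl⟩ := Nat.exists_eq_add_of_le' hr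
  have hidx : i + 1 + (j + 1) - 1 = i + j + 1 := by omega
  rw [hidx]
  have hne : acs g (i + j + 1) ⊓ (acs g (i + j + 1)).map J ≠ ⊥ := by
    intro hdisj
    have := finrank_acs_add_two_le (by omega) hdim hnil hJ2 hN hdisj
    rcases finrank_acs_growth hnil hdim hJ2 hN h j with ⟨-, hfin⟩ | hfin <;> omega
  refine ⟨hne, ?_⟩
  rcases finrank_acs_growth hnil hdim hJ2 hN h j with ⟨hdisj | hfin, -⟩ | hfin
  · exact absurd hdisj hne
  · omega
  · exact hfin
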